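/- arXiv:1603.07365 — 2 statements merged into one kernel-verified Lean document; each statement's English description precedes it below -/
import Mathlib

section
/- Let p be real, let X be a real-valued random variable and Y a complex-valued random variable with E[|Y|·|X|^p] < ∞ (and, if p < 0, Y = 0 almost surely on {X = 0}). Let g₁ ∈ 𝒢_p be odd and g₂ ∈ 𝒢_p be even, each satisfying E[|Y| ∫_ε^T |g_i(tX)| dt] < ∞ for all 0 < ε < T < ∞, and assume c_p^+(g₁)·c_p^+(g₂) ≠ 0. Then E[Y·X_+^p] = (1/(2·c_p^+(g₁)·c_p^+(g₂))) · lim_{ε↓0, T↑∞} ∫_ε^T ( c_p^+(g₁)·E[Y·g₂(tX)] + c_p^+(g₂)·E[Y·g₁(tX)] )/t^{p+1} dt. -/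
open MeasureTheory Filter Set Topology

/-- `x₊ᵖ`: equals `x^p` if `x > 0` and `0` otherwise (convention `0^0 = 0`). -/
noncomputable def posPow (x p : ℝ) : ℝ := if 0 < x then x ^ p else 0

/-- A function on `(0, ∞)` with a convergent improper integral has bounded integrals over all
positive intervals. -/
theorem exists_bound_intervalIntegral_of_tendsto {f : ℝ → ℂ} {c : ℂ}
    (hf : ∀ a b : ℝ, 0 < a → 0 < b → IntervalIntegrable f volume a b)
    (hc : Tendsto (fun q : ℝ × ℝ => ∫ t in q.1..q.2, f t) ((𝓝[>] (0 : ℝ)) ×ˢ atTop) (𝓝 c)) :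
    ∃ M : ℝ, ∀ a b : ℝ, 0 < a → 0 < b → ‖∫ t in a..b, f t‖ ≤ M := by
  have hev : ∀ᶠ q : ℝ × ℝ in (𝓝[>] (0 : ℝ)) ×ˢ atTop, ‖∫ t in q.1..q.2, f t‖ < ‖c‖ + 1 :=
    hc.norm.eventually (gt_mem_nhds (lt_add_one _))
  obtain ⟨P, hP, Q, hQ, hPQ⟩ := eventually_prod_iff.1 hev
  obtain ⟨δ, hδ, hPδ⟩ := mem_nhdsGT_iff_exists_Ioc_subset.1 hP
  obtain ⟨R₀, hR₀⟩ := eventually_atTop.1 hQ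
  have hδ0 : 0 < δ := hδ
  have hR : 0 < max R₀ 1 := lt_max_of_lt_right one_pos
  generalize hRdef : max R₀ 1 = R at hR
  have hQR : ∀ b, R ≤ b → Q b := fun b hb => hR₀ b ((le_max_left _ _).trans (hRdef.trans_le hb))
  have hcont : ContinuousOn (fun b => ∫ t in (1 : ℝ)..b, f t) (Icc δ R) := by
    rcases le_or_gt δ R with h | h
    · have hm : 0 < min 1 δ := lt_min one_pos hδ0
      have hM : 0 < max 1 R := lt_max_of_lt_left one_pos
      refine (intervalIntegral.continuousOn_primitive_interval' (hf _ _ hm hM) ?_).mono ?_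
      · rw [uIcc_of_le ((min_le_left _ _).trans (le_max_left _ _))]
        exact ⟨min_le_left _ _, le_max_left _ _⟩
      · rw [uIcc_of_le ((min_le_left _ _).trans (le_max_left _ _))]
        exact Icc_subset_Icc (min_le_right _ _) (le_max_right _ _)
    · simp [Icc_eq_empty_of_lt h]
  obtain ⟨K, hK⟩ := isCompact_Icc.exists_bound_of_continuousOn hcont
  have hsub : ∀ a b : ℝ, 0 < a → 0 < b →
      (∫ t in a..b, f t) = (∫ t in (1 : ℝ)..b, f t) - ∫ t in (1 : ℝ)..a, f t := fun a b ha hb =>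
    (intervalIntegral.integral_interval_sub_left (hf _ _ one_pos hb) (hf _ _ one_pos ha)).symm
  have hprim : ∃ B : ℝ, ∀ b : ℝ, 0 < b → ‖∫ t in (1 : ℝ)..b, f t‖ ≤ B := by
    refine ⟨max K 0 + (‖c‖ + 1) + ‖∫ t in (1 : ℝ)..δ, f t‖ + ‖∫ t in (1 : ℝ)..R, f t‖,
      fun b hb => ?_⟩
    have h0 := norm_nonneg (∫ t in (1 : ℝ)..δ, f t)
    have h1 := norm_nonneg (∫ t in (1 : ℝ)..R, f t)
    have h2 := norm_nonneg c
    have h3 := le_max_left K 0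
    have h4 := le_max_right K 0
    rcases le_or_gt R b with hRb | hbR
    · have h := hPQ (hPδ ⟨hδ0, le_rfl⟩) (hQR b hRb)
      simp only [hsub δ b hδ0 hb] at h
      have := norm_sub_norm_le (∫ t in (1 : ℝ)..b, f t) (∫ t in (1 : ℝ)..δ, f t)
      linarith
    rcases le_or_gt b δ with hbδ | hδb
    · have h := hPQ (hPδ ⟨hb, hbδ⟩) (hQR R le_rfl)
      simp only [hsub b R hb hR] at h
      have := norm_sub_norm_le (∫ t in (1 : ℝ)..b, f t) (∫ t in (1 : ℝ)..R, f t)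
      rw [norm_sub_rev] at this
      linarith
    · have := hK b ⟨hδb.le, hbR.le⟩
      linarith
  obtain ⟨B, hB⟩ := hprim
  refine ⟨B + B, fun a b ha hb => ?_⟩
  rw [hsub a b ha hb]
  exact (norm_sub_le _ _).trans (add_le_add (hB b hb) (hB a ha))

theorem eventually_pos_and_lt_nhdsGT_prod_atTop :
    ∀ᶠ q : ℝ × ℝ in (𝓝[>] (0 : ℝ)) ×ˢ atTop, 0 < q.1 ∧ q.1 < q.2 := by
  have h1 : ∀ᶠ q : ℝ × ℝ in (𝓝[>] (0 : ℝ)) ×ˢ atTop, q.1 ∈ Ioo (0 : ℝ) 1 :=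
    tendsto_fst.eventually (Ioo_mem_nhdsGT one_pos)
  have h2 : ∀ᶠ q : ℝ × ℝ in (𝓝[>] (0 : ℝ)) ×ˢ atTop, 1 ≤ q.2 :=
    tendsto_snd.eventually (eventually_ge_atTop 1)
  filter_upwards [h1, h2] with q hq1 hq2 using ⟨hq1.1, hq1.2.trans_le hq2⟩

theorem continuousOn_inv_ofReal_rpow (r : ℝ) :
    ContinuousOn (fun t : ℝ => (((t ^ r : ℝ) : ℂ))⁻¹) (Ioi 0) := by
  refine ContinuousOn.inv₀ (Complex.continuous_ofReal.comp_continuousOn ?_) fun t ht => ?_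
  · exact continuousOn_id.rpow_const fun t ht => Or.inl (ne_of_gt ht)
  · exact_mod_cast (Real.rpow_pos_of_pos ht _).ne'

theorem posPow_nonneg (x p : ℝ) : 0 ≤ posPow x p := by
  unfold posPow
  split_ifs with h
  · positivity
  · rfl

theorem posPow_le_abs_rpow (x p : ℝ) : posPow x p ≤ |x| ^ p := by
  unfold posPow
  split_ifs with h
  · rw [abs_of_pos h]
  · positivity

theorem measurable_posPow (p : ℝ) : Measurable fun x => posPow x p :=
  Measurable.ite measurableSet_Ioi (measurable_id.pow_const p) measurable_const

/-- Scaling of the truncated integral of `g (t * x) / t ^ (p + 1)` for positive `x`. -/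
theorem intervalIntegral_comp_mul_div_rpow (g : ℝ → ℂ) (p : ℝ) {x ε T : ℝ} (hx : 0 < x)
    (hε : 0 < ε) (hT : 0 < T) :
    (∫ t in ε..T, g (t * x) / ((t ^ (p + 1) : ℝ) : ℂ)) =
      ((x ^ p : ℝ) : ℂ) * ∫ t in (ε * x)..(T * x), g t / ((t ^ (p + 1) : ℝ) : ℂ) := by
  have h1 : (∫ t in ε..T, g (t * x) / ((t ^ (p + 1) : ℝ) : ℂ)) =
      ∫ t in ε..T, ((x ^ (p + 1) : ℝ) : ℂ) *
        (g (t * x) / (((t * x) ^ (p + 1) : ℝ) : ℂ)) := by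
    refine intervalIntegral.integral_congr fun t ht => ?_
    have ht0 : 0 < t := (lt_min hε hT).trans_le ht.1
    have hx' : ((x ^ (p + 1) : ℝ) : ℂ) ≠ 0 := by
      exact_mod_cast (Real.rpow_pos_of_pos hx _).ne'
    have ht' : ((t ^ (p + 1) : ℝ) : ℂ) ≠ 0 := by
      exact_mod_cast (Real.rpow_pos_of_pos ht0 _).ne'
    simp only [Real.mul_rpow ht0.le hx.le, Complex.ofReal_mul]
    field_simp
  rw [h1, intervalIntegral.integral_const_mul,
    intervalIntegral.integral_comp_mul_right (fun t => g t / ((t ^ (p + 1) : ℝ) : ℂ)) hx.ne',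
    Complex.real_smul, ← mul_assoc, ← Complex.ofReal_mul, Real.rpow_add_one hx.ne',
    mul_assoc, mul_inv_cancel₀ hx.ne', mul_one]

/-- The scaling identity for a `g` with parity `g (-t) = s * g t` and arbitrary real `x`. -/
theorem intervalIntegral_comp_mul_div_rpow_of_parity {g : ℝ → ℂ} {s : ℂ} (p : ℝ)
    (hpar : ∀ t, g (-t) = s * g t) (hg0 : g 0 = 0) (x : ℝ) {ε T : ℝ}
    (hε : 0 < ε) (hT : 0 < T) :
    (∫ t in ε..T, g (t * x) / ((t ^ (p + 1) : ℝ) : ℂ)) =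
      ((posPow x p : ℂ) + s * (posPow (-x) p : ℂ)) *
        ∫ t in (ε * |x|)..(T * |x|), g t / ((t ^ (p + 1) : ℝ) : ℂ) := by
  rcases lt_trichotomy x 0 with hx | rfl | hx
  · have hx' : 0 < -x := neg_pos.2 hx
    have h : ∀ t, g (t * x) / ((t ^ (p + 1) : ℝ) : ℂ) =
        s * (g (t * -x) / ((t ^ (p + 1) : ℝ) : ℂ)) := fun t => by
      rw [← mul_div_assoc, ← hpar]
      simp
    simp_rw [h]
    rw [intervalIntegral.integral_const_mul,
      intervalIntegral_comp_mul_div_rpow g p hx' hε hT, abs_of_neg hx]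
    simp [posPow, hx, hx.not_gt, mul_assoc]
  · simp [hg0]
  · rw [intervalIntegral_comp_mul_div_rpow g p hx hε hT, abs_of_pos hx]
    simp [posPow, hx, hx.not_gt]

section Truncated

variable {Ω : Type*} [MeasurableSpace Ω] {μ : Measure Ω} {p : ℝ} {X : Ω → ℝ} {Y : Ω → ℂ}
  {g : ℝ → ℂ}

theorem integrable_mul_posPow (hX : Measurable X) (hY : AEStronglyMeasurable Y μ)
    (hmom : Integrable (fun ω => ‖Y ω‖ * |X ω| ^ p) μ) :
    Integrable (fun ω => Y ω * (posPow (X ω) p : ℂ)) μ := by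
  refine hmom.mono (hY.mul ?_) (ae_of_all _ fun ω => ?_)
  · exact (Complex.measurable_ofReal.comp
      ((measurable_posPow p).comp hX)).aestronglyMeasurable
  · rw [norm_mul, norm_mul, norm_norm, Complex.norm_real]
    refine mul_le_mul_of_nonneg_left ?_ (norm_nonneg _)
    rw [Real.norm_of_nonneg (posPow_nonneg _ _)]
    exact (posPow_le_abs_rpow _ _).trans (le_abs_self _)

/-- Joint integrability of `Y * g (t * X) / t ^ (p + 1)` on a truncated strip. -/
theorem integrable_prod_mul_comp_div_rpow [SFinite μ] (p : ℝ) (hX : Measurable X)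
    (hY : AEStronglyMeasurable Y μ) (hloc : LocallyIntegrable g volume) (hmeas : Measurable g)
    (hg0 : g 0 = 0) {ε T : ℝ} (hε : 0 < ε) (hεT : ε < T)
    (hint : Integrable (fun ω => ‖Y ω‖ * ∫ t in ε..T, ‖g (t * X ω)‖) μ) :
    Integrable (fun z : Ω × ℝ => Y z.1 * g (z.2 * X z.1) / ((z.2 ^ (p + 1) : ℝ) : ℂ))
      (μ.prod (volume.restrict (Ioc ε T))) := by
  have hbase : Integrable (fun z : Ω × ℝ => Y z.1 * g (z.2 * X z.1))
      (μ.prod (volume.restrict (Ioc ε T))) := by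
    have hm : AEStronglyMeasurable (fun z : Ω × ℝ => Y z.1 * g (z.2 * X z.1))
        (μ.prod (volume.restrict (Ioc ε T))) :=
      hY.comp_fst.mul (hmeas.comp
        (measurable_snd.mul (hX.comp measurable_fst))).aestronglyMeasurable
    refine (integrable_prod_iff hm).2 ⟨ae_of_all _ fun ω => ?_, ?_⟩
    · change Integrable (fun t => Y ω * g (t * X ω)) (volume.restrict (Ioc ε T))
      refine Integrable.const_mul ?_ _
      rcases eq_or_ne (X ω) 0 with h0 | h0
      · simp [h0, hg0]
      · have h : IntervalIntegrable g volume (ε * X ω) (T * X ω) :=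
          (hloc.integrableOn_isCompact isCompact_uIcc).intervalIntegrable
        have h' := h.comp_mul_right (c := X ω)
        rw [mul_div_cancel_right₀ _ h0, mul_div_cancel_right₀ _ h0] at h'
        exact h'.1
    · refine hint.congr (ae_of_all _ fun ω => ?_)
      simp only [norm_mul, integral_const_mul, intervalIntegral.integral_of_le hεT.le]
  have hcont : ContinuousOn (fun t : ℝ => (((t ^ (p + 1) : ℝ) : ℂ))⁻¹) (Icc ε T) :=
    (continuousOn_inv_ofReal_rpow _).mono fun t ht => hε.trans_le ht.1
  obtain ⟨K, hK⟩ := isCompact_Icc.exists_bound_of_continuousOn hcont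
  have hbd : ∀ᵐ z ∂(μ.prod (volume.restrict (Ioc ε T))),
      ‖(((z.2 ^ (p + 1) : ℝ) : ℂ))⁻¹‖ ≤ K := by
    have h : ∀ᵐ t ∂(volume.restrict (Ioc ε T)), ‖(((t ^ (p + 1) : ℝ) : ℂ))⁻¹‖ ≤ K :=
      (ae_restrict_iff' measurableSet_Ioc).2
        (ae_of_all _ fun t ht => hK t (Ioc_subset_Icc_self ht))
    exact Measure.quasiMeasurePreserving_snd.ae h
  refine hbase.mul_bdd (c := K) ?_ hbd
  exact (Complex.measurable_ofReal.comp
    (measurable_snd.pow_const (p + 1))).inv.aestronglyMeasurable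

/-- The truncated integral of `𝔼[Y * g (t * X)] / t ^ (p + 1)` is interval integrable. -/
theorem intervalIntegrable_integral_mul_comp_div_rpow [SFinite μ] (p : ℝ) (hX : Measurable X)
    (hY : AEStronglyMeasurable Y μ) (hloc : LocallyIntegrable g volume) (hmeas : Measurable g)
    (hg0 : g 0 = 0) {ε T : ℝ} (hε : 0 < ε) (hεT : ε < T)
    (hint : Integrable (fun ω => ‖Y ω‖ * ∫ t in ε..T, ‖g (t * X ω)‖) μ) :
    IntervalIntegrable (fun t => (∫ ω, Y ω * g (t * X ω) ∂μ) / ((t ^ (p + 1) : ℝ) : ℂ))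
      volume ε T := by
  rw [intervalIntegrable_iff_integrableOn_Ioc_of_le hεT.le]
  have h := (integrable_prod_mul_comp_div_rpow p hX hY hloc hmeas hg0 hε hεT
    hint).integral_prod_right
  simpa only [integral_div, IntegrableOn] using h

/-- Fubini followed by scaling for the truncated integrals. -/
theorem intervalIntegral_integral_mul_comp_div_rpow [SFinite μ] {s : ℂ}
    (hpar : ∀ t, g (-t) = s * g t) (hX : Measurable X)
    (hY : AEStronglyMeasurable Y μ) (hloc : LocallyIntegrable g volume) (hmeas : Measurable g)
    (hg0 : g 0 = 0) {ε T : ℝ} (hε : 0 < ε) (hεT : ε < T)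
    (hint : Integrable (fun ω => ‖Y ω‖ * ∫ t in ε..T, ‖g (t * X ω)‖) μ) :
    (∫ t in ε..T, (∫ ω, Y ω * g (t * X ω) ∂μ) / ((t ^ (p + 1) : ℝ) : ℂ)) =
      ∫ ω, Y ω * ((posPow (X ω) p : ℂ) + s * (posPow (-X ω) p : ℂ)) *
        (∫ t in (ε * |X ω|)..(T * |X ω|), g t / ((t ^ (p + 1) : ℝ) : ℂ)) ∂μ := by
  have h := integral_integral_swap
    (f := fun ω t => Y ω * g (t * X ω) / ((t ^ (p + 1) : ℝ) : ℂ))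
    (integrable_prod_mul_comp_div_rpow p hX hY hloc hmeas hg0 hε hεT hint)
  simp only [integral_div] at h
  rw [intervalIntegral.integral_of_le hεT.le, ← h]
  refine integral_congr_ae (ae_of_all _ fun ω => ?_)
  simp only [mul_div_assoc, integral_const_mul]
  rw [← intervalIntegral.integral_of_le hεT.le,
    intervalIntegral_comp_mul_div_rpow_of_parity p hpar hg0 (X ω) hε (hε.trans hεT), mul_assoc]

/-- The moment limit for a single `g` with parity `g (-t) = s * g t`. -/
theorem tendsto_intervalIntegral_integral_mul_comp_div_rpow [SFinite μ] {s c : ℂ}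
    (hX : Measurable X) (hY : AEStronglyMeasurable Y μ)
    (hmom : Integrable (fun ω => ‖Y ω‖ * |X ω| ^ p) μ)
    (hpar : ∀ t, g (-t) = s * g t)
    (hloc : LocallyIntegrable g volume) (hmeas : Measurable g) (hg0 : g 0 = 0)
    (hc : Tendsto (fun q : ℝ × ℝ => ∫ t in q.1..q.2, g t / ((t ^ (p + 1) : ℝ) : ℂ))
      ((𝓝[>] (0 : ℝ)) ×ˢ atTop) (𝓝 c))
    (hint : ∀ ε T : ℝ, 0 < ε → ε < T →
      Integrable (fun ω => ‖Y ω‖ * ∫ t in ε..T, ‖g (t * X ω)‖) μ) :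
    Tendsto (fun q : ℝ × ℝ =>
        ∫ t in q.1..q.2, (∫ ω, Y ω * g (t * X ω) ∂μ) / ((t ^ (p + 1) : ℝ) : ℂ))
      ((𝓝[>] (0 : ℝ)) ×ˢ atTop)
      (𝓝 (∫ ω, Y ω * ((posPow (X ω) p : ℂ) + s * (posPow (-X ω) p : ℂ)) * c ∂μ)) := by
  have hf : ∀ a b : ℝ, 0 < a → 0 < b →
      IntervalIntegrable (fun t => g t / ((t ^ (p + 1) : ℝ) : ℂ)) volume a b := by
    intro a b ha hb
    have h : IntervalIntegrable g volume a b :=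
      (hloc.integrableOn_isCompact isCompact_uIcc).intervalIntegrable
    exact h.mul_continuousOn ((continuousOn_inv_ofReal_rpow (p + 1)).mono
      fun t ht => (lt_min ha hb).trans_le ht.1)
  obtain ⟨M, hM⟩ := exists_bound_intervalIntegral_of_tendsto hf hc
  have hpos := eventually_pos_and_lt_nhdsGT_prod_atTop
  have hw : Integrable
      (fun ω => Y ω * ((posPow (X ω) p : ℂ) + s * (posPow (-X ω) p : ℂ))) μ := by
    have h1 := integrable_mul_posPow hX hY hmom
    have h2 : Integrable (fun ω => Y ω * (posPow (-X ω) p : ℂ)) μ :=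
      integrable_mul_posPow hX.neg hY (by simpa using hmom)
    refine (h1.add (h2.const_mul s)).congr (ae_of_all _ fun ω => ?_)
    simp only [Pi.add_apply]
    ring
  have hHm : ∀ q : ℝ × ℝ, 0 < q.1 ∧ q.1 < q.2 → AEStronglyMeasurable (fun ω =>
      Y ω * ((posPow (X ω) p : ℂ) + s * (posPow (-X ω) p : ℂ)) *
        ∫ t in (q.1 * |X ω|)..(q.2 * |X ω|), g t / ((t ^ (p + 1) : ℝ) : ℂ)) μ := by
    intro q hq
    have h := (integrable_prod_mul_comp_div_rpow p hX hY hloc hmeas hg0 hq.1 hq.2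
      (hint _ _ hq.1 hq.2)).integral_prod_left.aestronglyMeasurable
    refine h.congr (ae_of_all _ fun ω => ?_)
    simp only [mul_div_assoc, integral_const_mul]
    rw [← intervalIntegral.integral_of_le hq.2.le,
      intervalIntegral_comp_mul_div_rpow_of_parity p hpar hg0 (X ω) hq.1 (hq.1.trans hq.2),
      mul_assoc]
  have hlim := tendsto_integral_filter_of_dominated_convergence
    (l := (𝓝[>] (0 : ℝ)) ×ˢ (atTop : Filter ℝ))
    (F := fun (q : ℝ × ℝ) ω => Y ω * ((posPow (X ω) p : ℂ) + s * (posPow (-X ω) p : ℂ)) *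
        ∫ t in (q.1 * |X ω|)..(q.2 * |X ω|), g t / ((t ^ (p + 1) : ℝ) : ℂ))
    (f := fun ω => Y ω * ((posPow (X ω) p : ℂ) + s * (posPow (-X ω) p : ℂ)) * c)
    (μ := μ)
    (fun ω => ‖Y ω * ((posPow (X ω) p : ℂ) + s * (posPow (-X ω) p : ℂ))‖ * M)
    (hpos.mono hHm) ?_ (hw.norm.mul_const M) ?_
  · refine hlim.congr' (hpos.mono fun q hq => ?_)
    exact (intervalIntegral_integral_mul_comp_div_rpow hpar hX hY hloc hmeas hg0 hq.1 hq.2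
      (hint _ _ hq.1 hq.2)).symm
  · refine hpos.mono fun q hq => ae_of_all _ fun ω => ?_
    rcases eq_or_ne (X ω) 0 with h0 | h0
    · simp [h0, posPow]
    · have hx : 0 < |X ω| := abs_pos.2 h0
      rw [norm_mul]
      exact mul_le_mul_of_nonneg_left
        (hM _ _ (mul_pos hq.1 hx) (mul_pos (hq.1.trans hq.2) hx)) (norm_nonneg _)
  · refine ae_of_all _ fun ω => ?_
    rcases eq_or_ne (X ω) 0 with h0 | h0
    · simp [h0, posPow]
    · have hx : 0 < |X ω| := abs_pos.2 h0
      have hl : Tendsto (fun e : ℝ => e * |X ω|) (𝓝[>] (0 : ℝ)) (𝓝[>] (0 : ℝ)) := by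
        refine tendsto_nhdsWithin_iff.2 ⟨?_, ?_⟩
        · have := (continuous_mul_const |X ω|).tendsto (0 : ℝ)
          rw [zero_mul] at this
          exact this.mono_left nhdsWithin_le_nhds
        · filter_upwards [self_mem_nhdsWithin] with e he using mul_pos he hx
      have hr : Tendsto (fun T : ℝ => T * |X ω|) atTop atTop := tendsto_id.atTop_mul_const hx
      exact (hc.comp (hl.prodMap hr)).const_mul _

end Truncated

theorem stmt2 {Ω : Type*} [MeasurableSpace Ω] (μ : Measure Ω) [IsProbabilityMeasure μ]
    (p : ℝ) (X : Ω → ℝ) (Y : Ω → ℂ)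
    (hX : Measurable X) (hY : AEStronglyMeasurable Y μ)
    (hmom : Integrable (fun ω => ‖Y ω‖ * |X ω| ^ p) μ)
    (hneg : p < 0 → ∀ᵐ ω ∂μ, X ω = 0 → Y ω = 0)
    (g₁ g₂ : ℝ → ℂ) (c₁ c₂ : ℂ)
    (hodd : ∀ t : ℝ, g₁ (-t) = -g₁ t) (heven : ∀ t : ℝ, g₂ (-t) = g₂ t)
    (hloc₁ : LocallyIntegrable g₁ volume) (hmeas₁ : Measurable g₁) (hg₁0 : g₁ 0 = 0)
    (hloc₂ : LocallyIntegrable g₂ volume) (hmeas₂ : Measurable g₂) (hg₂0 : g₂ 0 = 0)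
    (hc₁ : Tendsto (fun q : ℝ × ℝ => ∫ t in q.1..q.2, g₁ t / ((t ^ (p + 1) : ℝ) : ℂ))
      ((𝓝[>] (0:ℝ)) ×ˢ atTop) (𝓝 c₁))
    (hc₂ : Tendsto (fun q : ℝ × ℝ => ∫ t in q.1..q.2, g₂ t / ((t ^ (p + 1) : ℝ) : ℂ))
      ((𝓝[>] (0:ℝ)) ×ˢ atTop) (𝓝 c₂))
    (hint₁ : ∀ ε T : ℝ, 0 < ε → ε < T →
      Integrable (fun ω => ‖Y ω‖ * ∫ t in ε..T, ‖g₁ (t * X ω)‖) μ)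
    (hint₂ : ∀ ε T : ℝ, 0 < ε → ε < T →
      Integrable (fun ω => ‖Y ω‖ * ∫ t in ε..T, ‖g₂ (t * X ω)‖) μ)
    (hne : c₁ * c₂ ≠ 0) :
    ∃ L : ℂ,
      Tendsto
        (fun q : ℝ × ℝ =>
          ∫ t in q.1..q.2,
            (c₁ * (∫ ω, Y ω * g₂ (t * X ω) ∂μ) + c₂ * ∫ ω, Y ω * g₁ (t * X ω) ∂μ)
              / ((t ^ (p + 1) : ℝ) : ℂ))
        ((𝓝[>] (0:ℝ)) ×ˢ atTop) (𝓝 L) ∧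
      (∫ ω, Y ω * (posPow (X ω) p : ℂ) ∂μ) = (1 / (2 * c₁ * c₂)) * L := by
  have h₁ := tendsto_intervalIntegral_integral_mul_comp_div_rpow (s := -1) hX hY hmom
    (fun t => by rw [hodd, neg_one_mul]) hloc₁ hmeas₁ hg₁0 hc₁ hint₁
  have h₂ := tendsto_intervalIntegral_integral_mul_comp_div_rpow (s := 1) hX hY hmom
    (fun t => by rw [heven, one_mul]) hloc₂ hmeas₂ hg₂0 hc₂ hint₂
  refine ⟨_, ((h₂.const_mul c₁).add (h₁.const_mul c₂)).congr' ?_, ?_⟩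
  · filter_upwards [eventually_pos_and_lt_nhdsGT_prod_atTop] with q ⟨hq1, hq⟩
    have i₁ := intervalIntegrable_integral_mul_comp_div_rpow p hX hY hloc₁ hmeas₁ hg₁0 hq1 hq
      (hint₁ _ _ hq1 hq)
    have i₂ := intervalIntegrable_integral_mul_comp_div_rpow p hX hY hloc₂ hmeas₂ hg₂0 hq1 hq
      (hint₂ _ _ hq1 hq)
    rw [← intervalIntegral.integral_const_mul, ← intervalIntegral.integral_const_mul,
      ← intervalIntegral.integral_add (i₂.const_mul c₁) (i₁.const_mul c₂)]
    refine intervalIntegral.integral_congr fun t _ => ?_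
    simp only [add_div, mul_div_assoc]
  · have j₁ := integrable_mul_posPow hX hY hmom
    have j₂ : Integrable (fun ω => Y ω * (posPow (-X ω) p : ℂ)) μ :=
      integrable_mul_posPow hX.neg hY (by simpa using hmom)
    have e : ∀ s : ℂ, (∫ ω, Y ω * ((posPow (X ω) p : ℂ) + s * (posPow (-X ω) p : ℂ)) ∂μ) =
        (∫ ω, Y ω * (posPow (X ω) p : ℂ) ∂μ) +
          s * ∫ ω, Y ω * (posPow (-X ω) p : ℂ) ∂μ := fun s => by
      rw [← integral_const_mul, ← integral_add j₁ (j₂.const_mul s)]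
      refine integral_congr_ae (ae_of_all _ fun ω => ?_)
      ring
    have hc1 := left_ne_zero_of_mul hne
    have hc2 := right_ne_zero_of_mul hne
    simp only [integral_mul_const, e]
    field_simp
    ring
end

section
/- Let p ∈ (0,∞) \ ℕ, set ℓ := ⌈p−1⌉ and λ := p − ℓ ∈ (0,1), and let X be a real random variable with E|X|^p < ∞. For w ∈ ℝ define F(w) := i^p · E[conj(X^p)·e^{iwX}] and G(w) := i^p · E[conj((−X)^p)·e^{iwX}] (the fractional derivatives of order p of the characteristic functions of X and of −X, the latter evaluated with reversed argument). Then for every u ∈ ℝ, E[X_+^p·e^{iuX}] = (1/(2·i^{ℓ+1}·sin(πλ))) · ( i^λ·F(u) − (−1)^ℓ·i^{−λ}·G(u) ). -/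
open MeasureTheory Filter Set Topology

/-- Principal complex power of a real number, with the convention `0 ^ s = 0`. -/
noncomputable def rcpow (x s : ℝ) : ℂ := if x = 0 then 0 else (x : ℂ) ^ (s : ℂ)

open Complex in
lemma I_cpow_ofReal (r : ℝ) : I ^ (r : ℂ) = exp (Real.pi / 2 * I * r) := by
  rw [cpow_def_of_ne_zero I_ne_zero, log_I]

lemma measurable_rcpow (p : ℝ) : Measurable fun x : ℝ => rcpow x p := by
  unfold rcpow
  exact Measurable.ite (measurableSet_singleton 0) measurable_const (by fun_prop)

lemma rcpow_of_pos {x : ℝ} (hx : 0 < x) (p : ℝ) : rcpow x p = ((x ^ p : ℝ) : ℂ) := by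
  rw [rcpow, if_neg hx.ne', Complex.ofReal_cpow hx.le]

lemma rcpow_neg_of_pos {x : ℝ} (hx : 0 < x) (p : ℝ) :
    rcpow (-x) p = ((x ^ p : ℝ) : ℂ) * Complex.exp (Real.pi * Complex.I * p) := by
  rw [rcpow, if_neg (neg_ne_zero.2 hx.ne'), Complex.ofReal_cpow_of_nonpos (by linarith),
    Complex.ofReal_cpow hx.le]
  simp

lemma rcpow_zero_left (p : ℝ) : rcpow 0 p = 0 := if_pos rfl

lemma norm_rcpow_le (x : ℝ) (p : ℝ) : ‖rcpow x p‖ ≤ |x| ^ p := by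
  rcases lt_trichotomy x 0 with hx | rfl | hx
  · obtain ⟨y, rfl⟩ : ∃ y, x = -y := ⟨-x, by simp⟩
    have hy : 0 < y := by linarith
    rw [rcpow_neg_of_pos hy, norm_mul, Complex.norm_exp, abs_neg, abs_of_pos hy]
    simp [abs_of_nonneg (Real.rpow_nonneg hy.le p)]
  · rw [rcpow_zero_left, norm_zero]
    positivity
  · rw [rcpow_of_pos hx, abs_of_pos hx, Complex.norm_real, Real.norm_eq_abs,
      abs_of_nonneg (Real.rpow_nonneg hx.le p)]

lemma conj_exp_pi_mul_I (p : ℝ) :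
    (starRingEnd ℂ) (Complex.exp (Real.pi * Complex.I * p))
      = Complex.exp (-(Real.pi * Complex.I * p)) := by
  rw [← Complex.exp_conj]
  simp

lemma exp_neg_pi_mul_I_nat (n : ℕ) :
    Complex.exp (-(Real.pi * Complex.I * n)) = (-1) ^ n := by
  rw [show -(Real.pi * Complex.I * n) = n * -(Real.pi * Complex.I) by ring, Complex.exp_nat_mul,
    Complex.exp_neg, Complex.exp_pi_mul_I]
  norm_num

/-- The two principal powers `xᵖ` and `(-x)ᵖ` combine linearly to `x₊ᵖ`. -/
lemma posPow_eq_conj_rcpow (x lam : ℝ) (n : ℕ) :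
    2 * Complex.I ^ (n + 1) * (Real.sin (Real.pi * lam) : ℂ) * (posPow x (n + lam) : ℂ)
      = Complex.I ^ (lam : ℂ) * Complex.I ^ ((n + lam : ℝ) : ℂ)
          * (starRingEnd ℂ) (rcpow x (n + lam))
        - (-1) ^ n * Complex.I ^ ((-lam : ℝ) : ℂ) * Complex.I ^ ((n + lam : ℝ) : ℂ)
          * (starRingEnd ℂ) (rcpow (-x) (n + lam)) := by
  have hsum : Complex.I ^ (lam : ℂ) * Complex.I ^ ((n + lam : ℝ) : ℂ)
      = Complex.I ^ n * Complex.exp (Real.pi * lam * Complex.I) := by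
    rw [I_cpow_ofReal, I_cpow_ofReal, ← Complex.cpow_natCast,
      ← Complex.ofReal_natCast, I_cpow_ofReal, ← Complex.exp_add, ← Complex.exp_add]
    push_cast
    ring_nf
  have hdiff : Complex.I ^ ((-lam : ℝ) : ℂ) * Complex.I ^ ((n + lam : ℝ) : ℂ)
      = Complex.I ^ n := by
    rw [I_cpow_ofReal, I_cpow_ofReal, ← Complex.cpow_natCast,
      ← Complex.ofReal_natCast, I_cpow_ofReal, ← Complex.exp_add]
    push_cast
    ring_nf
  have hrot : Complex.exp (-(Real.pi * Complex.I * ((n + lam : ℝ) : ℂ)))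
      = (-1) ^ n * Complex.exp (-(Real.pi * lam * Complex.I)) := by
    rw [← exp_neg_pi_mul_I_nat, ← Complex.exp_add]
    push_cast
    ring_nf
  have hsq : ((-1 : ℂ) ^ n) * (-1) ^ n = 1 := by
    rw [← mul_pow]
    norm_num
  have hinv : Complex.exp (Real.pi * lam * Complex.I)
      * Complex.exp (-(Real.pi * lam * Complex.I)) = 1 := by
    rw [← Complex.exp_add, add_neg_cancel, Complex.exp_zero]
  rw [hsum, mul_assoc ((-1 : ℂ) ^ n), hdiff]
  rcases lt_trichotomy x 0 with hx | rfl | hx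
  · obtain ⟨y, rfl⟩ : ∃ y, x = -y := ⟨-x, by simp⟩
    have hy : 0 < y := by linarith
    rw [posPow, if_neg (by linarith), neg_neg, rcpow_of_pos hy, rcpow_neg_of_pos hy, map_mul,
      conj_exp_pi_mul_I, Complex.conj_ofReal, hrot]
    push_cast
    linear_combination (-(Complex.I ^ n * ((y ^ (n + lam) : ℝ) : ℂ) * (-1) ^ n)) * hinv
  · simp [posPow, rcpow_zero_left]
  · rw [posPow, if_pos hx, rcpow_of_pos hx, rcpow_neg_of_pos hx, map_mul,
      conj_exp_pi_mul_I, Complex.conj_ofReal, hrot, Complex.ofReal_sin, Complex.sin]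
    push_cast
    rw [neg_mul, pow_succ]
    linear_combination
      (Complex.I ^ n * ((x ^ (n + lam) : ℝ) : ℂ)
        * Complex.exp (-(Real.pi * lam * Complex.I))) * hsq
      + (Complex.I ^ n * ((x ^ (n + lam) : ℝ) : ℂ)
        * (Complex.exp (-(Real.pi * lam * Complex.I))
          - Complex.exp (Real.pi * lam * Complex.I))) * Complex.I_sq

lemma integrable_conj_rcpow_mul_exp {Ω : Type*} [MeasurableSpace Ω] {μ : Measure Ω} {p : ℝ}
    {X Y : Ω → ℝ} (hX : Measurable X) (hY : Measurable Y)
    (hmom : Integrable (fun ω => |Y ω| ^ p) μ) (u : ℝ) :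
    Integrable (fun ω => (starRingEnd ℂ) (rcpow (Y ω) p)
      * Complex.exp (Complex.I * u * X ω)) μ := by
  have hrc : Measurable fun ω => rcpow (Y ω) p := (measurable_rcpow p).comp hY
  refine hmom.mono' ?_ (.of_forall fun ω => ?_)
  · exact ((Complex.continuous_conj.measurable.comp hrc).mul (by fun_prop)).aestronglyMeasurable
  · rw [norm_mul, RCLike.norm_conj, Complex.norm_exp]
    simpa using norm_rcpow_le (Y ω) p

theorem stmt9 {Ω : Type*} [MeasurableSpace Ω] (μ : Measure Ω) [IsProbabilityMeasure μ]
    (p : ℝ) (hp : 0 < p) (hpn : ¬∃ n : ℕ, (n : ℝ) = p)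
    (ℓ : ℕ) (hl : ℓ = ⌈p - 1⌉₊) (lam : ℝ) (hlam : lam = p - ℓ)
    (X : Ω → ℝ) (hX : Measurable X)
    (hmom : Integrable (fun ω => |X ω| ^ p) μ)
    (F G : ℝ → ℂ)
    (hF : F = fun (w : ℝ) => Complex.I ^ (p : ℂ) *
      ∫ ω, (starRingEnd ℂ) (rcpow (X ω) p) * Complex.exp (Complex.I * w * X ω) ∂μ)
    (hG : G = fun (w : ℝ) => Complex.I ^ (p : ℂ) *
      ∫ ω, (starRingEnd ℂ) (rcpow (-(X ω)) p) * Complex.exp (Complex.I * w * X ω) ∂μ) :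
    ∀ u : ℝ,
      (∫ ω, (posPow (X ω) p : ℂ) * Complex.exp (Complex.I * u * X ω) ∂μ)
        = (1 / (2 * Complex.I ^ (ℓ + 1) * (Real.sin (Real.pi * lam) : ℂ)))
          * (Complex.I ^ ((lam : ℝ) : ℂ) * F u
            - (-1 : ℂ) ^ ℓ * Complex.I ^ ((-lam : ℝ) : ℂ) * G u) := by
  intro u
  obtain rfl : p = ℓ + lam := by rw [hlam]; ring
  have hsin : (Real.sin (Real.pi * lam) : ℂ) ≠ 0 := by
    rw [Complex.ofReal_ne_zero, Ne, Real.sin_eq_zero_iff]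
    rintro ⟨k, hk⟩
    have hk : (k : ℝ) = lam := by
      rw [mul_comm] at hk
      exact mul_left_cancel₀ Real.pi_ne_zero hk
    have hpos : 0 < (ℓ : ℤ) + k := by
      rw [← hk] at hp
      exact_mod_cast hp
    refine hpn ⟨((ℓ : ℤ) + k).toNat, ?_⟩
    rw [← hk, ← Int.cast_natCast, Int.toNat_of_nonneg hpos.le]
    push_cast
    rfl
  have hc : 2 * Complex.I ^ (ℓ + 1) * (Real.sin (Real.pi * lam) : ℂ) ≠ 0 :=
    mul_ne_zero (mul_ne_zero two_ne_zero (pow_ne_zero _ Complex.I_ne_zero)) hsin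
  have hintF := integrable_conj_rcpow_mul_exp hX hX hmom u
  have hintG := integrable_conj_rcpow_mul_exp (Y := fun ω => -X ω) (p := ℓ + lam) hX hX.neg
    (by simpa using hmom) u
  rw [one_div, eq_inv_mul_iff_mul_eq₀ hc, hF, hG]
  simp only [← mul_assoc]
  rw [← integral_const_mul, ← integral_const_mul, ← integral_const_mul,
    ← integral_sub (hintF.const_mul _) (hintG.const_mul _)]
  refine integral_congr_ae (.of_forall fun ω => ?_)
  have h := posPow_eq_conj_rcpow (X ω) lam ℓ
  beta_reduce
  linear_combination Complex.exp (Complex.I * u * X ω) * h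
end
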